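/- arXiv:1107.1502 — 5 statements merged into one kernel-verified Lean document; each statement's English description precedes it below -/
import Mathlib

section
/- Let X be a paracompact Hausdorff space and let W be a collection of subsets of X satisfying: (M1) if A ∈ W and U is an open subset of X contained in A, then U ∈ W; (M2) if U₁ and U₂ are open subsets of X with U₁, U₂ ∈ W, then U₁ ∪ U₂ ∈ W; (M3) if {U_s}_{s∈S} is a family of open subsets of X that is discrete in X and every U_s is a member of W, then ⋃_{s∈S} U_s ∈ W. If for every point a of X there is A ∈ W such that a lies in the interior of A, then X ∈ W. -/
/-- A family `{U s}` of subsets of `X` is discrete in `X` if every point of `X` has a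
neighbourhood meeting `U s` for at most one `s`. -/
def DiscreteFamily {X : Type u} [TopologicalSpace X] {S : Type v} (U : S → Set X) : Prop :=
  ∀ x : X, ∃ V ∈ nhds x, {s : S | (U s ∩ V).Nonempty}.Subsingleton

open Set Filter Topology

/-- A locally finite family of continuous functions is equicontinuous. -/
theorem LocallyFinite.eventually_forall_abs_sub_lt {X : Type*} {ι : Type*} [TopologicalSpace X]
    {f : ι → C(X, ℝ)} (hf : LocallyFinite fun i => Function.support (f i)) (x : X) {δ : ℝ}
    (hδ : 0 < δ) : ∀ᶠ y in 𝓝 x, ∀ i, |f i y - f i x| < δ := by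
  obtain ⟨t, ht, hfin⟩ := hf x
  have hcont : ∀ᶠ y in 𝓝 x, ∀ i ∈ {i | (Function.support (f i) ∩ t).Nonempty},
      |f i y - f i x| < δ := by
    refine (eventually_all_finite hfin).2 fun i _ => ?_
    have := Metric.tendsto_nhds.1 ((f i).continuous.tendsto x) δ hδ
    simpa only [Real.dist_eq] using this
  filter_upwards [ht, hcont] with y hy h i
  by_cases hi : (Function.support (f i) ∩ t).Nonempty
  · exact h i hi
  · have hzero : ∀ z ∈ t, f i z = 0 := fun z hz => by
      by_contra hne
      exact hi ⟨z, hne, hz⟩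
    simpa [hzero y hy, hzero x (mem_of_mem_nhds ht)] using hδ

/-- Preimages under a continuous real function of uniformly separated sets form a discrete
family. -/
theorem DiscreteFamily.preimage_of_separated {X : Type*} {S : Type*} [TopologicalSpace X]
    {g : X → ℝ} (hg : Continuous g) {I : S → Set ℝ} {δ : ℝ} (hδ : 0 < δ)
    (hI : ∀ s t, ∀ a ∈ I s, ∀ b ∈ I t, |a - b| < δ → s = t) :
    DiscreteFamily fun s => g ⁻¹' I s := by
  intro x
  refine ⟨g ⁻¹' Metric.ball (g x) (δ / 2),
    hg.continuousAt.preimage_mem_nhds (Metric.ball_mem_nhds _ (half_pos hδ)), ?_⟩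
  rintro s ⟨y, hys, hy⟩ t ⟨z, hzt, hz⟩
  refine hI s t _ hys _ hzt ?_
  rw [mem_preimage, Metric.mem_ball, Real.dist_eq, abs_lt] at hy hz
  rw [abs_lt]
  constructor <;> linarith [hy.1, hy.2, hz.1, hz.2]

/-- For a countable open cover there is a continuous function, bounded below by `1`, each of
whose strict sublevel sets at a natural number is covered by finitely many members. -/
theorem exists_continuous_sublevel_subset_biUnion {X : Type*} [TopologicalSpace X] [NormalSpace X]
    [ParacompactSpace X] {O : ℕ → Set X} (hO : ∀ k, IsOpen (O k)) (hcov : ⋃ k, O k = univ) :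
    ∃ g : X → ℝ, Continuous g ∧ (∀ x, 1 ≤ g x) ∧
      ∀ K : ℕ, {x | g x < K} ⊆ ⋃ k ∈ Finset.range K, O k := by
  obtain ⟨ρ, hρ⟩ := PartitionOfUnity.exists_isSubordinate isClosed_univ O hO hcov.ge
  have hfin : ∀ (x : X) (c : ℕ → ℝ), (Function.support fun k => ρ k x * c k).Finite := fun x c =>
    (ρ.locallyFinite.point_finite x).subset fun k hk => left_ne_zero_of_mul hk
  have hle : ∀ (x : X) (K : ℕ), (∀ k, k + 1 < K → ρ k x = 0) →
      (K : ℝ) ≤ ∑ᶠ k : ℕ, ρ k x * ((k : ℝ) + 1) := by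
    intro x K hK
    have hsum : ∑ᶠ k, ρ k x * (K : ℝ) = K := by
      rw [← finsum_mul, ρ.sum_eq_one (mem_univ x), one_mul]
    rw [← sub_nonneg, ← hsum, ← finsum_sub_distrib (hfin x _) (hfin x _)]
    refine finsum_nonneg fun k => sub_nonneg.2 ?_
    by_cases hk : k + 1 < K
    · simp [hK k hk]
    · refine mul_le_mul_of_nonneg_left ?_ (ρ.nonneg k x)
      exact_mod_cast not_lt.1 hk
  refine ⟨fun x => ∑ᶠ k : ℕ, ρ k x * ((k : ℝ) + 1), ?_, fun x => ?_, fun K x hx => ?_⟩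
  · exact ρ.continuous_finsum_smul (g := fun k _ => (k : ℝ) + 1)
      fun _ _ _ => continuousAt_const
  · simpa using hle x 1 fun k hk => by omega
  · by_contra hnot
    refine (not_le.2 hx) (hle x K fun k hk => ?_)
    by_contra hne
    refine hnot (mem_biUnion (Finset.mem_coe.2 (Finset.mem_range.2 (by omega : k < K))) ?_)
    exact hρ k (subset_tsupport _ hne)

/-- The points where every member of the family indexed by `F` exceeds by more than `ε` both `0`
and every member not indexed by `F`. -/
def dominanceSet {X : Type*} {ι : Type*} [TopologicalSpace X] (f : ι → C(X, ℝ)) (ε : ℝ)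
    (F : Finset ι) : Set X :=
  {y | ∀ i ∈ F, ε < f i y ∧ ∀ j ∉ F, f j y + ε < f i y}

theorem discreteFamily_interior_dominanceSet {X : Type*} {ι : Type*} [TopologicalSpace X]
    {f : ι → C(X, ℝ)} (hf : LocallyFinite fun i => Function.support (f i)) {ε : ℝ} (hε : 0 < ε)
    (n : ℕ) :
    DiscreteFamily fun F : {F : Finset ι // F.card = n} => interior (dominanceSet f ε F.1) := by
  intro x
  refine ⟨_, hf.eventually_forall_abs_sub_lt x (half_pos hε), ?_⟩
  have hlt : ∀ F : Finset ι, (interior (dominanceSet f ε F) ∩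
      {y | ∀ i, |f i y - f i x| < ε / 2}).Nonempty → ∀ i ∈ F, ∀ j ∉ F, f j x < f i x := by
    rintro F ⟨y, hyF, hy⟩ i hi j hj
    have := (interior_subset hyF i hi).2 j hj
    linarith [(abs_lt.1 (hy i)).2, (abs_lt.1 (hy j)).1]
  rintro ⟨F, hF⟩ hFx ⟨G, hG⟩ hGx
  rw [Subtype.mk.injEq]
  by_contra hne
  have hFG : ¬ F ⊆ G := fun h => hne (Finset.eq_of_subset_of_card_le h (by omega))
  have hGF : ¬ G ⊆ F := fun h => hne (Finset.eq_of_subset_of_card_le h (by omega)).symm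
  obtain ⟨i, hiF, hiG⟩ := Finset.not_subset.1 hFG
  obtain ⟨j, hjG, hjF⟩ := Finset.not_subset.1 hGF
  exact lt_asymm (hlt F hFx i hiF j hjF) (hlt G hGx j hjG i hiG)

theorem exists_mem_interior_dominanceSet {X : Type*} {ι : Type*} [TopologicalSpace X]
    (ρ : PartitionOfUnity ι X) (x : X) :
    ∃ (n m : ℕ) (F : Finset ι), F.card = n + 1 ∧
      x ∈ interior (dominanceSet ρ (1 / ((m : ℝ) + 1)) F) := by
  have hfin : {i | ρ i x ≠ 0}.Finite := ρ.locallyFinite.point_finite x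
  have hmem : ∀ i, i ∈ hfin.toFinset ↔ ρ i x ≠ 0 := fun i => hfin.mem_toFinset
  obtain ⟨i₀, hi₀⟩ := ρ.exists_pos (mem_univ x)
  have hne : hfin.toFinset.Nonempty := ⟨i₀, (hmem i₀).2 hi₀.ne'⟩
  obtain ⟨i₁, hi₁, hmin⟩ := hfin.toFinset.exists_min_image (fun i => ρ i x) hne
  have hpos : 0 < ρ i₁ x := (ρ.nonneg i₁ x).lt_of_ne' ((hmem i₁).1 hi₁)
  obtain ⟨m, hm⟩ := exists_nat_one_div_lt (by positivity : 0 < ρ i₁ x / 3)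
  refine ⟨hfin.toFinset.card - 1, m, hfin.toFinset, ?_, ?_⟩
  · have := hne.card_pos
    omega
  · rw [mem_interior_iff_mem_nhds]
    have hε : 0 < 1 / ((m : ℝ) + 1) := by positivity
    filter_upwards [ρ.locallyFinite.eventually_forall_abs_sub_lt x hε] with y hy i hi
    have hi' := hmin i hi
    have hyi := (abs_lt.1 (hy i)).1
    refine ⟨by linarith, fun j hj => ?_⟩
    have hjx : ρ j x = 0 := by simpa [hmem] using hj
    linarith [(abs_lt.1 (hy j)).2]

/-- Michael's lemma: if `W` is a collection of subsets of a paracompact Hausdorff space `X`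
satisfying (M1)–(M3) and every point of `X` lies in the interior of some member of `W`,
then `X ∈ W`. -/
theorem michael_lemma {X : Type u} [TopologicalSpace X] [ParacompactSpace X] [T2Space X]
    (W : Set (Set X))
    (hM1 : ∀ A ∈ W, ∀ U : Set X, IsOpen U → U ⊆ A → U ∈ W)
    (hM2 : ∀ U₁ U₂ : Set X, IsOpen U₁ → IsOpen U₂ → U₁ ∈ W → U₂ ∈ W → U₁ ∪ U₂ ∈ W)
    (hM3 : ∀ (S : Type u) (U : S → Set X), (∀ s, IsOpen (U s)) → DiscreteFamily U →
      (∀ s, U s ∈ W) → (⋃ s, U s) ∈ W)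
    (hpt : ∀ a : X, ∃ A ∈ W, a ∈ interior A) :
    Set.univ ∈ W := by
  have hempty : ∅ ∈ W := by
    have := hM3 PEmpty (fun _ => ∅) (fun _ => isOpen_empty)
      (fun _ => ⟨univ, univ_mem, fun s => s.elim⟩) (fun s => s.elim)
    simpa using this
  choose A hAW hA using hpt
  obtain ⟨ρ, hρ⟩ := PartitionOfUnity.exists_isSubordinate isClosed_univ
    (fun a => interior (A a)) (fun _ => isOpen_interior) fun a _ => mem_iUnion.2 ⟨a, hA a⟩
  let G : ℕ → ℕ → Set X := fun n m => ⋃ F : {F : Finset X // F.card = n + 1},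
    interior (dominanceSet ρ (1 / ((m : ℝ) + 1)) F.1)
  have hGW : ∀ n m, G n m ∈ W := by
    intro n m
    have hε : 0 < 1 / ((m : ℝ) + 1) := by positivity
    refine hM3 _ _ (fun _ => isOpen_interior)
      (discreteFamily_interior_dominanceSet ρ.locallyFinite hε (n + 1)) ?_
    rintro ⟨F, hF⟩
    obtain ⟨i, hi⟩ := Finset.card_pos.1 (by omega : 0 < F.card)
    refine hM1 (A i) (hAW i) _ isOpen_interior fun y hy => interior_subset (hρ i ?_)
    exact subset_tsupport _ (hε.trans (interior_subset hy i hi).1).ne'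
  have hGopen : ∀ n m, IsOpen (G n m) := fun n m => isOpen_iUnion fun _ => isOpen_interior
  let O : ℕ → Set X := fun k => G k.unpair.1 k.unpair.2
  have hO : ∀ k, IsOpen (O k) := fun k => hGopen _ _
  have hcov : ⋃ k, O k = univ := by
    refine eq_univ_of_forall fun x => ?_
    obtain ⟨n, m, F, hF, hx⟩ := exists_mem_interior_dominanceSet ρ x
    refine mem_iUnion.2 ⟨Nat.pair n m, ?_⟩
    simp only [O, Nat.unpair_pair]
    exact mem_iUnion.2 ⟨⟨F, hF⟩, hx⟩
  have hfinite : ∀ K : ℕ, (⋃ k ∈ Finset.range K, O k) ∈ W := by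
    intro K
    induction K with
    | zero => simpa using hempty
    | succ K ih =>
      rw [Finset.range_add_one, Finset.set_biUnion_insert]
      exact hM2 _ _ (hO K) (isOpen_biUnion fun k _ => hO k) (hGW _ _) ih
  obtain ⟨g, hg, hg1, hgO⟩ := exists_continuous_sublevel_subset_biUnion hO hcov
  have hband : ∀ c : ℕ,
      (⋃ k : ULift.{u} ℕ, g ⁻¹' Ioo (4 * (k.down : ℝ) + c) (4 * k.down + c + 3)) ∈ W := by
    intro c
    refine hM3 _ _ (fun _ => isOpen_Ioo.preimage hg)
      (DiscreteFamily.preimage_of_separated hg one_pos ?_) fun k => ?_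
    · rintro ⟨s⟩ ⟨t⟩ a ⟨ha, ha'⟩ b ⟨hb, hb'⟩ hab
      rw [abs_lt] at hab
      have hst : (s : ℝ) < t + 1 := by linarith [hab.1, hab.2]
      have hts : (t : ℝ) < s + 1 := by linarith [hab.1, hab.2]
      norm_cast at hst hts
      exact congrArg ULift.up (by omega)
    · refine hM1 _ (hfinite (4 * k.down + c + 3)) _ (isOpen_Ioo.preimage hg)
        (Subset.trans (fun x hx => ?_) (hgO _))
      simpa using hx.2
  have hunion := hM2 _ _ (isOpen_iUnion fun _ => isOpen_Ioo.preimage hg)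
    (isOpen_iUnion fun _ => isOpen_Ioo.preimage hg) (hband 0) (hband 2)
  refine hM1 _ hunion _ isOpen_univ fun x _ => ?_
  have hx := hg1 x
  let k := ⌊g x / 4⌋₊
  have hk : (k : ℝ) ≤ g x / 4 := Nat.floor_le (by linarith)
  have hk' : g x / 4 < k + 1 := Nat.lt_floor_add_one _
  by_cases hhigh : 4 * (k : ℝ) + 2 < g x
  · refine Or.inr (mem_iUnion.2 ⟨⟨k⟩, ?_, ?_⟩) <;> push_cast <;> linarith
  · rcases hk.lt_or_eq with hlow | heq
    · refine Or.inl (mem_iUnion.2 ⟨⟨k⟩, ?_, ?_⟩) <;> push_cast <;> linarith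
    · have hkpos : 0 < k := by
        have : (0 : ℝ) < k := by linarith
        exact_mod_cast this
      obtain ⟨l, hl⟩ : ∃ l, k = l + 1 := ⟨k - 1, by omega⟩
      have hl' : (k : ℝ) = l + 1 := by exact_mod_cast hl
      refine Or.inr (mem_iUnion.2 ⟨⟨l⟩, ?_, ?_⟩) <;> push_cast <;> linarith
end

section
/- Let X be a paracompact Hausdorff space whose underlying set is infinite. Then comp(X) is the least cardinal α with the following property: every locally finite open cover of X consisting of nonempty sets has cardinality less than α. -/
open Cardinal

/-- `compCard X` is the least infinite cardinal `α` such that every open cover of `X`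
has a subcover of cardinality less than `α`. -/
noncomputable def compCard (X : Type*) [TopologicalSpace X] : Cardinal :=
  sInf {α : Cardinal | ℵ₀ ≤ α ∧ ∀ 𝒰 : Set (Set X), (∀ U ∈ 𝒰, IsOpen U) → ⋃₀ 𝒰 = Set.univ →
    ∃ 𝒱 ⊆ 𝒰, ⋃₀ 𝒱 = Set.univ ∧ #𝒱 < α}

/-- If every locally finite open cover of an infinite T₁ space by nonempty sets has fewer than
`α` members, then `α` is infinite. -/
theorem aleph0_le_of_forall_locallyFinite {X : Type*} [TopologicalSpace X] [T1Space X]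
    [Infinite X] {α : Cardinal}
    (h : ∀ 𝒰 : Set (Set X), (∀ U ∈ 𝒰, IsOpen U ∧ U.Nonempty) → ⋃₀ 𝒰 = Set.univ →
      LocallyFinite (fun U : 𝒰 => (U : Set X)) → #𝒰 < α) : ℵ₀ ≤ α := by
  refine aleph0_le.2 fun n => ?_
  obtain ⟨s, hs⟩ := Infinite.exists_subset_card_eq X n
  set 𝒰 : Set (Set X) := insert Set.univ ((fun x : X => ({x}ᶜ : Set X)) '' (s : Set X))
  have hfin : 𝒰.Finite := (s.finite_toSet.image _).insert _
  have : Finite 𝒰 := hfin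
  have hinj : Function.Injective fun x : X => ({x}ᶜ : Set X) :=
    compl_injective.comp Set.singleton_injective
  have hlt : #𝒰 < α := by
    refine h 𝒰 ?_ ?_ (locallyFinite_of_finite _)
    · rintro U (rfl | ⟨x, -, rfl⟩)
      · exact ⟨isOpen_univ, Set.univ_nonempty⟩
      · exact ⟨isOpen_compl_singleton, (Set.finite_singleton x).infinite_compl.nonempty⟩
    · exact Set.eq_univ_of_univ_subset (Set.subset_sUnion_of_mem (Set.mem_insert _ _))
  refine le_trans ?_ hlt.le
  calc (n : Cardinal) = #((fun x : X => ({x}ᶜ : Set X)) '' (s : Set X)) := by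
        rw [mk_image_eq hinj]; simp [hs]
    _ ≤ #𝒰 := mk_le_mk_of_subset (Set.subset_insert _ _)

/-- In a paracompact space, a strict bound on the cardinalities of locally finite open covers by
nonempty sets lets one extract from any open cover a subcover obeying the same bound. -/
theorem exists_subcover_mk_lt_of_forall_locallyFinite {X : Type*} [TopologicalSpace X]
    [ParacompactSpace X] {α : Cardinal}
    (h : ∀ 𝒰 : Set (Set X), (∀ U ∈ 𝒰, IsOpen U ∧ U.Nonempty) → ⋃₀ 𝒰 = Set.univ →
      LocallyFinite (fun U : 𝒰 => (U : Set X)) → #𝒰 < α)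
    {𝒰 : Set (Set X)} (ho : ∀ U ∈ 𝒰, IsOpen U) (hc : ⋃₀ 𝒰 = Set.univ) :
    ∃ 𝒱 ⊆ 𝒰, ⋃₀ 𝒱 = Set.univ ∧ #𝒱 < α := by
  obtain ⟨v, vo, vc, vf, vs⟩ := precise_refinement (fun U : 𝒰 => (U : Set X))
    (fun U => ho U U.2) (by rw [← Set.sUnion_eq_iUnion, hc])
  set 𝒲 : Set (Set X) := {W | W ∈ Set.range v ∧ W.Nonempty}
  have hlt : #𝒲 < α := by
    refine h 𝒲 ?_ ?_ ?_
    · rintro W ⟨⟨a, rfl⟩, hW⟩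
      exact ⟨vo a, hW⟩
    · refine Set.eq_univ_of_forall fun x => ?_
      obtain ⟨a, ha⟩ := Set.mem_iUnion.1 (vc ▸ Set.mem_univ x)
      exact ⟨v a, ⟨⟨a, rfl⟩, x, ha⟩, ha⟩
    · exact vf.on_range.comp_injective
        (Set.inclusion_injective fun W (hW : W ∈ 𝒲) => hW.1)
  choose g hg using fun W : 𝒲 => W.2.1
  refine ⟨Set.range fun W => (g W : Set X), ?_, ?_, mk_range_le.trans_lt hlt⟩
  · rintro _ ⟨W, rfl⟩
    exact (g W).2
  · refine Set.eq_univ_of_forall fun x => ?_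
    obtain ⟨a, ha⟩ := Set.mem_iUnion.1 (vc ▸ Set.mem_univ x)
    let W : 𝒲 := ⟨v a, ⟨a, rfl⟩, x, ha⟩
    refine ⟨_, ⟨W, rfl⟩, vs (g W) ?_⟩
    rw [hg W]
    exact ha

/-- If every open cover has a subcover with fewer than `α` members, `α` infinite, then every
locally finite family of nonempty sets has fewer than `α` members. -/
theorem mk_lt_of_locallyFinite_of_forall_exists_subcover {X : Type*} [TopologicalSpace X]
    {α : Cardinal} (hα : ℵ₀ ≤ α)
    (h : ∀ 𝒰 : Set (Set X), (∀ U ∈ 𝒰, IsOpen U) → ⋃₀ 𝒰 = Set.univ →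
      ∃ 𝒱 ⊆ 𝒰, ⋃₀ 𝒱 = Set.univ ∧ #𝒱 < α)
    {𝒰 : Set (Set X)} (hne : ∀ U ∈ 𝒰, U.Nonempty)
    (hf : LocallyFinite (fun U : 𝒰 => (U : Set X))) : #𝒰 < α := by
  obtain ⟨𝒱, h𝒱, hc, hlt⟩ := h
    {V | IsOpen V ∧ {U : 𝒰 | ((U : Set X) ∩ V).Nonempty}.Finite} (fun V hV => hV.1) (by
      refine Set.eq_univ_of_forall fun x => ?_
      obtain ⟨t, ht, hfin⟩ := hf x
      obtain ⟨V, hVt, hVo, hxV⟩ := mem_nhds_iff.1 ht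
      exact ⟨V, ⟨hVo, hfin.subset fun U hU => hU.mono (Set.inter_subset_inter_right _ hVt)⟩,
        hxV⟩)
  have hcover : (Set.univ : Set 𝒰) ⊆ ⋃ V : 𝒱, {U : 𝒰 | ((U : Set X) ∩ V).Nonempty} := by
    intro U _
    obtain ⟨x, hx⟩ := hne U U.2
    obtain ⟨V, hV, hxV⟩ := Set.mem_sUnion.1 (hc ▸ Set.mem_univ x)
    exact Set.mem_iUnion.2 ⟨⟨V, hV⟩, x, hx, hxV⟩
  rcases finite_or_infinite 𝒱 with hfin | hinf
  · have : (Set.univ : Set 𝒰).Finite := (Set.finite_iUnion fun V : 𝒱 => (h𝒱 V.2).2).subset hcover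
    have : Finite 𝒰 := Set.finite_univ_iff.1 this
    exact (lt_aleph0_of_finite 𝒰).trans_le hα
  · refine lt_of_le_of_lt ?_ hlt
    calc #𝒰 = #(Set.univ : Set 𝒰) := mk_univ.symm
      _ ≤ #(⋃ V : 𝒱, {U : 𝒰 | ((U : Set X) ∩ V).Nonempty}) := mk_le_mk_of_subset hcover
      _ ≤ sum fun V : 𝒱 => #{U : 𝒰 | ((U : Set X) ∩ V).Nonempty} := mk_iUnion_le_sum_mk
      _ ≤ sum fun _ : 𝒱 => ℵ₀ := sum_le_sum _ _ fun V => (h𝒱 V.2).2.lt_aleph0.le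
      _ = #𝒱 := by rw [sum_const', mul_aleph0_eq (aleph0_le_mk 𝒱)]

/-- For an infinite paracompact Hausdorff space `X`, `compCard X` is the least cardinal `α`
such that every locally finite open cover of `X` consisting of nonempty sets has cardinality
less than `α`. -/
theorem compCard_eq_sInf_locallyFinite (X : Type*) [TopologicalSpace X] [ParacompactSpace X]
    [T2Space X] [Infinite X] :
    compCard X = sInf {α : Cardinal |
      ∀ 𝒰 : Set (Set X), (∀ U ∈ 𝒰, IsOpen U ∧ U.Nonempty) → ⋃₀ 𝒰 = Set.univ →
        LocallyFinite (fun U : 𝒰 => (U : Set X)) → #𝒰 < α} := by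
  refine congrArg sInf (Set.ext fun α => ⟨?_, fun h => ⟨?_, ?_⟩⟩)
  · rintro ⟨hα, h⟩ 𝒰 hU - hf
    exact mk_lt_of_locallyFinite_of_forall_exists_subcover hα h (fun U hU' => (hU U hU').2) hf
  · exact aleph0_le_of_forall_locallyFinite h
  · exact fun 𝒰 ho hc => exists_subcover_mk_lt_of_forall_locallyFinite h ho hc
end

section
/- Let X be a paracompact Hausdorff space whose underlying set is infinite. Then comp(X) is the least cardinal α such that every discrete subset of X has cardinality less than α. -/
open Cardinal

/-- If every open cover has a subcover of cardinality less than `α`, then every closed discrete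
set has cardinality less than `α`. -/
theorem mk_lt_of_forall_subcover {X : Type*} [TopologicalSpace X] {α : Cardinal}
    (hα : ∀ 𝒰 : Set (Set X), (∀ U ∈ 𝒰, IsOpen U) → ⋃₀ 𝒰 = Set.univ →
      ∃ 𝒱 ⊆ 𝒰, ⋃₀ 𝒱 = Set.univ ∧ #𝒱 < α)
    {D : Set X} (hD : IsClosed D) (hdisc : DiscreteTopology D) : #D < α := by
  obtain ⟨𝒱, h𝒱, hcov, hlt⟩ := hα {U | IsOpen U ∧ (U ∩ D).Subsingleton} (fun U hU ↦ hU.1) (by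
    refine Set.eq_univ_of_forall fun x ↦ ?_
    by_cases hx : x ∈ D
    · obtain ⟨U, hU, hUD⟩ := isOpen_induced_iff.1 (isOpen_discrete ({⟨x, hx⟩} : Set D))
      have key (y : X) (hy : y ∈ D) : y ∈ U ↔ y = x := by
        simpa using Set.ext_iff.1 hUD ⟨y, hy⟩
      refine ⟨U, ⟨hU, fun a ha b hb ↦ ?_⟩, (key x hx).2 rfl⟩
      rw [(key a ha.2).1 ha.1, (key b hb.2).1 hb.1]
    · exact ⟨Dᶜ, ⟨hD.isOpen_compl, by simp⟩, hx⟩)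
  have hmem (d : D) : ∃ V ∈ 𝒱, (d : X) ∈ V := by
    simpa using Set.ext_iff.1 hcov d
  choose V hV hdV using hmem
  refine (mk_le_of_injective (f := fun d ↦ (⟨V d, hV d⟩ : 𝒱)) fun a b hab ↦ ?_).trans_lt hlt
  have hVab : V a = V b := congrArg Subtype.val hab
  exact Subtype.ext ((h𝒱 (hV a)).2 ⟨hdV a, a.2⟩ ⟨hVab ▸ hdV b, b.2⟩)

/-- A set meets the range of a locally finite family of points in a closed set. -/
theorem isClosed_range_inter_of_locallyFinite {ι X : Type*} [TopologicalSpace X] [T1Space X]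
    {f : ι → X} (hf : LocallyFinite fun i ↦ ({f i} : Set X)) (T : Set X) :
    IsClosed (Set.range f ∩ T) := by
  have h := (hf.subset (g := fun i ↦ {f i} ∩ T) fun i ↦ Set.inter_subset_left).isClosed_iUnion
    fun i ↦ ((Set.finite_singleton (f i)).inter_of_left T).isClosed
  rwa [← Set.iUnion_inter, Set.iUnion_singleton_eq_range] at h

/-- The range of a locally finite family of points is discrete. -/
theorem discreteTopology_range_of_locallyFinite {ι X : Type*} [TopologicalSpace X] [T1Space X]
    {f : ι → X} (hf : LocallyFinite fun i ↦ ({f i} : Set X)) :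
    DiscreteTopology (Set.range f) := by
  refine discreteTopology_iff_forall_isClosed.2 fun s ↦ ?_
  refine isClosed_induced_iff.2
    ⟨_, isClosed_range_inter_of_locallyFinite hf (Subtype.val '' s), ?_⟩
  ext x
  simp

/-- A locally finite family of nonempty sets in a T₁ space has cardinality less than any infinite
cardinal which strictly bounds the cardinalities of closed discrete subsets. -/
theorem LocallyFinite.mk_lt_of_forall_discrete.{u} {X ι : Type u} [TopologicalSpace X] [T1Space X]
    {v : ι → Set X} (hv : LocallyFinite v) (hne : ∀ i, (v i).Nonempty) {α : Cardinal}
    (hα₀ : ℵ₀ ≤ α) (hα : ∀ D : Set X, IsClosed D → DiscreteTopology D → #D < α) :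
    #ι < α := by
  choose f hf using hne
  have hlf : LocallyFinite fun i ↦ ({f i} : Set X) :=
    hv.subset fun i ↦ Set.singleton_subset_iff.2 (hf i)
  have hlt : #(Set.range f) < α := hα _
    (by simpa using isClosed_range_inter_of_locallyFinite hlf Set.univ)
    (discreteTopology_range_of_locallyFinite hlf)
  have hfib (y : Set.range f) : (Set.rangeFactorization f ⁻¹' {y}).Finite := by
    refine (hv.point_finite y).subset fun i hi ↦ ?_
    have hi : f i = y := congrArg Subtype.val hi
    exact hi ▸ hf i
  rcases finite_or_infinite (Set.range f) with hfin | hinf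
  · have : Finite ι := Set.finite_univ_iff.1 <|
      (Set.finite_univ (α := Set.range f)).preimage' fun y _ ↦ hfib y
    exact (lt_aleph0_of_finite ι).trans_le hα₀
  · refine (mk_le_mk_mul_of_mk_preimage_le (Set.rangeFactorization f)
      fun y ↦ (hfib y).lt_aleph0.le).trans_lt ?_
    rwa [mul_aleph0_eq (aleph0_le_mk _)]

/-- In an infinite T₁ space, a strict bound on the cardinalities of closed discrete subsets
is infinite. -/
theorem aleph0_le_of_forall_discrete {X : Type*} [TopologicalSpace X] [T1Space X] [Infinite X]
    {α : Cardinal} (hα : ∀ D : Set X, IsClosed D → DiscreteTopology D → #D < α) : ℵ₀ ≤ α := by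
  refine aleph0_le.2 fun n ↦ ?_
  obtain ⟨s, hs⟩ := Infinite.exists_subset_card_eq X n
  have h := hα s s.finite_toSet.isClosed inferInstance
  simpa [hs] using h.le

/-- For an infinite paracompact Hausdorff space `X`, `compCard X` is the least cardinal `α`
such that every discrete subset of `X` (a closed subset whose subspace topology is discrete)
has cardinality less than `α`. -/
theorem compCard_eq_sInf_discrete (X : Type*) [TopologicalSpace X] [ParacompactSpace X]
    [T2Space X] [Infinite X] :
    compCard X = sInf {α : Cardinal |
      ∀ D : Set X, IsClosed D → DiscreteTopology D → #D < α} := by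
  unfold compCard
  congr 1
  ext α
  refine ⟨fun h D hD hdisc ↦ mk_lt_of_forall_subcover h.2 hD hdisc, fun h ↦ ?_⟩
  have hα₀ := aleph0_le_of_forall_discrete h
  refine ⟨hα₀, fun 𝒰 hopen hcov ↦ ?_⟩
  obtain ⟨v, -, hvcov, hvlf, hvsub⟩ := precise_refinement (fun U : 𝒰 ↦ (U : Set X))
    (fun U ↦ hopen U U.2) (by rw [← Set.sUnion_eq_iUnion, hcov])
  refine ⟨Subtype.val '' {U : 𝒰 | (v U).Nonempty}, by simp, ?_, ?_⟩
  · refine Set.eq_univ_of_forall fun x ↦ ?_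
    obtain ⟨U, hU⟩ := Set.mem_iUnion.1 (hvcov ▸ Set.mem_univ x)
    exact ⟨U, ⟨U, ⟨x, hU⟩, rfl⟩, hvsub U hU⟩
  · refine mk_image_le.trans_lt ?_
    exact (hvlf.comp_injective Subtype.val_injective).mk_lt_of_forall_discrete
      (fun U : {U : 𝒰 | (v U).Nonempty} ↦ U.2) hα₀ h
end

section
/- Let X be a metrizable space whose underlying set is infinite. Then exactly one of the following holds: either (a) X contains a discrete subset of cardinality w(X), and in that case comp(X) is the cardinal successor of w(X); or (b) every discrete subset of X has cardinality less than w(X), and in that case comp(X) = w(X) and, moreover, there exists a strictly increasing sequence of cardinals α₀ < α₁ < α₂ < ⋯ with w(X) = sup_{n∈ℕ} αₙ. -/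
open Cardinal

/-- The topological weight of `X`: the least infinite cardinality of a base of the
topology of `X`. -/
noncomputable def tweight (X : Type*) [TopologicalSpace X] : Cardinal :=
  sInf {c : Cardinal | ℵ₀ ≤ c ∧
    ∃ B : Set (Set X), TopologicalSpace.IsTopologicalBasis B ∧ #B ≤ c}

theorem IsClosed.of_subset_of_discreteTopology {X : Type*} [TopologicalSpace X] {D S : Set X}
    (hD : IsClosed D) (hd : DiscreteTopology D) (hS : S ⊆ D) : IsClosed S := by
  have h := hD.isClosedEmbedding_subtypeVal.isClosedMap _
    (isClosed_discrete (Subtype.val ⁻¹' S : Set D))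
  rwa [Subtype.image_preimage_coe, Set.inter_eq_right.2 hS] at h

section

universe u

variable {X : Type u} [TopologicalSpace X]

theorem tweight_spec (X : Type u) [TopologicalSpace X] : ℵ₀ ≤ tweight X ∧
    ∃ B : Set (Set X), TopologicalSpace.IsTopologicalBasis B ∧ #B ≤ tweight X :=
  csInf_mem (s := {c : Cardinal | ℵ₀ ≤ c ∧
    ∃ B : Set (Set X), TopologicalSpace.IsTopologicalBasis B ∧ #B ≤ c})
    ⟨max ℵ₀ #{U : Set X | IsOpen U}, le_max_left _ _, _,
      TopologicalSpace.isTopologicalBasis_opens, le_max_right _ _⟩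

theorem tweight_le {B : Set (Set X)} (hB : TopologicalSpace.IsTopologicalBasis B) {c : Cardinal}
    (hc : ℵ₀ ≤ c) (hBc : #B ≤ c) : tweight X ≤ c :=
  csInf_le' ⟨hc, B, hB, hBc⟩

theorem exists_subcover_card_le_tweight (𝒰 : Set (Set X)) (ho : ∀ U ∈ 𝒰, IsOpen U)
    (hc : ⋃₀ 𝒰 = Set.univ) : ∃ 𝒱 ⊆ 𝒰, ⋃₀ 𝒱 = Set.univ ∧ #𝒱 ≤ tweight X := by
  obtain ⟨-, B, hB, hcard⟩ := tweight_spec X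
  let B' : Set (Set X) := {b ∈ B | ∃ U ∈ 𝒰, b ⊆ U}
  have hB' : ∀ b : B', ∃ U ∈ 𝒰, (b : Set X) ⊆ U := fun b => b.2.2
  choose f hf hbf using hB'
  refine ⟨Set.range f, ?_, ?_, ?_⟩
  · rintro _ ⟨b, rfl⟩
    exact hf b
  · refine Set.eq_univ_of_forall fun x => ?_
    obtain ⟨U, hU, hxU⟩ : x ∈ ⋃₀ 𝒰 := hc ▸ Set.mem_univ x
    obtain ⟨b, hb, hxb, hbU⟩ := hB.exists_subset_of_mem_open hxU (ho U hU)
    exact ⟨f ⟨b, hb, U, hU, hbU⟩, ⟨_, rfl⟩, hbf _ hxb⟩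
  · exact mk_range_le.trans ((mk_le_mk_of_subset (Set.sep_subset _ _)).trans hcard)

theorem compCard_spec (X : Type u) [TopologicalSpace X] : ℵ₀ ≤ compCard X ∧
    ∀ 𝒰 : Set (Set X), (∀ U ∈ 𝒰, IsOpen U) → ⋃₀ 𝒰 = Set.univ →
      ∃ 𝒱 ⊆ 𝒰, ⋃₀ 𝒱 = Set.univ ∧ #𝒱 < compCard X :=
  csInf_mem (s := {α : Cardinal | ℵ₀ ≤ α ∧
    ∀ 𝒰 : Set (Set X), (∀ U ∈ 𝒰, IsOpen U) → ⋃₀ 𝒰 = Set.univ →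
      ∃ 𝒱 ⊆ 𝒰, ⋃₀ 𝒱 = Set.univ ∧ #𝒱 < α})
    ⟨Order.succ (tweight X), (tweight_spec X).1.trans (Order.le_succ _), fun 𝒰 ho hc => by
      simpa only [Order.lt_succ_iff] using exists_subcover_card_le_tweight 𝒰 ho hc⟩

theorem compCard_le {α : Cardinal} (h₀ : ℵ₀ ≤ α)
    (h : ∀ 𝒰 : Set (Set X), (∀ U ∈ 𝒰, IsOpen U) → ⋃₀ 𝒰 = Set.univ →
      ∃ 𝒱 ⊆ 𝒰, ⋃₀ 𝒱 = Set.univ ∧ #𝒱 < α) : compCard X ≤ α :=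
  csInf_le' ⟨h₀, h⟩

theorem compCard_le_succ_tweight (X : Type u) [TopologicalSpace X] :
    compCard X ≤ Order.succ (tweight X) :=
  compCard_le ((tweight_spec X).1.trans (Order.le_succ _)) fun 𝒰 ho hc => by
    simpa only [Order.lt_succ_iff] using exists_subcover_card_le_tweight 𝒰 ho hc

theorem mk_lt_compCard_of_discreteTopology {D : Set X} (hD : IsClosed D)
    (hd : DiscreteTopology D) : #D < compCard X := by
  obtain rfl | ⟨d₀, hd₀⟩ := D.eq_empty_or_nonempty
  · simpa using aleph0_pos.trans_le (compCard_spec X).1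
  obtain ⟨𝒱, hsub, hcov, hlt⟩ := (compCard_spec X).2
    (Set.range fun d : D => (D \ {(d : X)})ᶜ)
    (by
      rintro _ ⟨d, rfl⟩
      exact (hD.of_subset_of_discreteTopology hd Set.sdiff_subset).isOpen_compl)
    (by
      refine Set.eq_univ_of_forall fun x => ?_
      by_cases hx : x ∈ D
      · exact ⟨_, ⟨⟨x, hx⟩, rfl⟩, by simp⟩
      · exact ⟨_, ⟨⟨d₀, hd₀⟩, rfl⟩, by simp [hx]⟩)
  have hmem : ∀ d : D, ∃ V : 𝒱, (d : X) ∈ (V : Set X) := fun d => by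
    obtain ⟨V, hV, hdV⟩ : (d : X) ∈ ⋃₀ 𝒱 := hcov ▸ Set.mem_univ _
    exact ⟨⟨V, hV⟩, hdV⟩
  choose f hf using hmem
  refine (mk_le_of_injective (f := f) fun d d' h => ?_).trans_lt hlt
  obtain ⟨e, he⟩ := hsub (f d).2
  have h₁ := hf d
  have h₂ := hf d'
  rw [← h, ← he] at h₂
  rw [← he] at h₁
  simp at h₁ h₂
  exact Subtype.ext (h₁.trans h₂.symm)

open Metric in
theorem exists_tweight_le_sum_of_subcover [TopologicalSpace.MetrizableSpace X] {μ : Cardinal}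
    (h : ∀ 𝒰 : Set (Set X), (∀ U ∈ 𝒰, IsOpen U) → ⋃₀ 𝒰 = Set.univ →
      ∃ 𝒱 ⊆ 𝒰, ⋃₀ 𝒱 = Set.univ ∧ #𝒱 < μ) :
    ∃ δ : ℕ → Cardinal, (∀ n, δ n < μ) ∧ tweight X ≤ max ℵ₀ (ℵ₀ * ⨆ n, δ n) := by
  let _ := TopologicalSpace.metrizableSpaceMetric X
  have hballs : ∀ n : ℕ, ∃ 𝒱 ⊆ Set.range fun x : X => ball x (1 / ((n : ℝ) + 1)),
      ⋃₀ 𝒱 = Set.univ ∧ #𝒱 < μ := fun n => by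
    refine h _ ?_ ?_
    · rintro _ ⟨x, rfl⟩
      exact isOpen_ball
    · exact Set.eq_univ_of_forall fun x =>
        ⟨_, ⟨x, rfl⟩, mem_ball_self Nat.one_div_pos_of_nat⟩
  choose 𝒱 hsub hcov hlt using hballs
  refine ⟨fun n => #(𝒱 n), hlt, tweight_le (B := ⋃ n, 𝒱 n) ?_ (le_max_left _ _) ?_⟩
  · refine TopologicalSpace.isTopologicalBasis_of_isOpen_of_nhds ?_ fun x U hx hU => ?_
    · intro V hV
      obtain ⟨n, hn⟩ := Set.mem_iUnion.1 hV
      obtain ⟨x, rfl⟩ := hsub n hn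
      exact isOpen_ball
    · obtain ⟨ε, hε, hball⟩ := Metric.isOpen_iff.1 hU x hx
      obtain ⟨n, hn⟩ := exists_nat_one_div_lt (half_pos hε)
      obtain ⟨V, hV, hxV⟩ : x ∈ ⋃₀ 𝒱 n := hcov n ▸ Set.mem_univ x
      refine ⟨V, Set.mem_iUnion.2 ⟨n, hV⟩, hxV, fun z hz => hball ?_⟩
      obtain ⟨y, rfl⟩ := hsub n hV
      rw [mem_ball] at hxV hz ⊢
      linarith [dist_triangle_right z x y]
  · refine le_max_of_le_right ?_
    have := mk_iUnion_le_lift 𝒱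
    simpa using this

theorem tweight_le_compCard [TopologicalSpace.MetrizableSpace X] : tweight X ≤ compCard X := by
  obtain ⟨h₀, h⟩ := compCard_spec X
  obtain ⟨δ, hδ, hle⟩ := exists_tweight_le_sum_of_subcover h
  refine hle.trans (max_le h₀ ?_)
  calc ℵ₀ * ⨆ n, δ n ≤ compCard X * compCard X :=
        mul_le_mul' h₀ (ciSup_le' fun n => (hδ n).le)
    _ = compCard X := mul_eq_self h₀

theorem exists_subcover_card_lt [ParacompactSpace X] [T2Space X] {κ : Cardinal} (h₀ : ℵ₀ ≤ κ)
    (hκ : ∀ D : Set X, IsClosed D → DiscreteTopology D → #D < κ) (𝒰 : Set (Set X))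
    (ho : ∀ U ∈ 𝒰, IsOpen U) (hc : ⋃₀ 𝒰 = Set.univ) :
    ∃ 𝒱 ⊆ 𝒰, ⋃₀ 𝒱 = Set.univ ∧ #𝒱 < κ := by
  obtain ⟨v, -, hvc, hvf, hvu⟩ := precise_refinement (fun U : 𝒰 => (U : Set X))
    (fun U => ho U U.2) (by rwa [← Set.sUnion_eq_iUnion])
  let I := {U : 𝒰 | (v U).Nonempty}
  choose x hx using fun U : I => U.2
  have hclosed : ∀ S ⊆ Set.range x, IsClosed S := fun S hS => by
    have hlf : LocallyFinite fun U : I => ({x U} ∩ S : Set X) :=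
      (hvf.comp_injective Subtype.val_injective).subset fun U =>
        Set.inter_subset_left.trans (Set.singleton_subset_iff.2 (hx U))
    have := hlf.isClosed_iUnion fun U =>
      ((Set.finite_singleton (x U)).inter_of_left S).isClosed
    rwa [← Set.iUnion_inter, Set.iUnion_singleton_eq_range, Set.inter_eq_right.2 hS] at this
  have hdisc : DiscreteTopology (Set.range x) := by
    refine discreteTopology_iff_forall_isClosed.2 fun S => ?_
    have := (hclosed (Subtype.val '' S) (Subtype.coe_image_subset _ _)).preimage
      (continuous_subtype_val (p := (· ∈ Set.range x)))
    rwa [Set.preimage_image_eq _ Subtype.val_injective] at this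
  have hD := hκ _ (hclosed _ subset_rfl) hdisc
  have hfib : ∀ y : Set.range x, (Set.rangeFactorization x ⁻¹' {y}).Finite := fun y => by
    refine ((hvf.point_finite (y : X)).preimage Subtype.val_injective.injOn).subset ?_
    rintro U rfl
    exact hx U
  have hI : #I < κ := by
    by_cases hfin : Finite (Set.range x)
    · have : Finite I := Set.finite_univ_iff.1 <|
        Set.Finite.of_finite_fibers (Set.rangeFactorization x) (Set.toFinite _)
          fun y _ => (hfib y).inter_of_right _
      exact (lt_aleph0_of_finite I).trans_le h₀
    · rw [not_finite_iff_infinite] at hfin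
      have := mk_le_mk_mul_of_mk_preimage_le (c := ℵ₀) (Set.rangeFactorization x)
        fun y => ((hfib y).lt_aleph0).le
      rw [mul_aleph0_eq (aleph0_le_mk _)] at this
      exact this.trans_lt hD
  refine ⟨Subtype.val '' I, Subtype.coe_image_subset _ _, ?_, mk_image_le.trans_lt hI⟩
  refine Set.eq_univ_of_forall fun y => ?_
  obtain ⟨U, hU⟩ := Set.mem_iUnion.1 (hvc ▸ Set.mem_univ y)
  exact ⟨U, ⟨U, ⟨y, hU⟩, rfl⟩, hvu U hU⟩

theorem Cardinal.exists_strictMono_eq_iSup {κ : Cardinal} {δ : ℕ → Cardinal}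
    (hδ : ∀ n, δ n < κ) (hκ : κ ≤ ⨆ n, δ n) :
    ∃ α : ℕ → Cardinal, StrictMono α ∧ κ = ⨆ n, α n := by
  have hsucc : ∀ c < κ, Order.succ c < κ := fun c hc => by
    obtain ⟨n, hn⟩ := exists_lt_of_lt_ciSup' (hc.trans_le hκ)
    exact (Order.succ_le_of_lt hn).trans_lt (hδ n)
  let α : ℕ → Cardinal := fun n => Nat.rec (δ 0) (fun n c => max (Order.succ c) (δ (n + 1))) n
  have hα : ∀ n, α n < κ := fun n => by
    induction n with
    | zero => exact hδ 0
    | succ n ih => exact max_lt (hsucc _ ih) (hδ _)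
  have hle : ∀ n, δ n ≤ α n := fun n => by
    cases n with
    | zero => exact le_rfl
    | succ n => exact le_max_right _ _
  refine ⟨α, strictMono_nat_of_lt_succ fun n => (Order.lt_succ _).trans_le (le_max_left _ _), ?_⟩
  exact (hκ.trans (ciSup_mono bddAbove_of_small hle)).antisymm (ciSup_le' fun n => (hα n).le)

theorem exists_strictMono_eq_tweight [TopologicalSpace.MetrizableSpace X]
    (h : ∀ D : Set X, IsClosed D → DiscreteTopology D → #D < tweight X) :
    ∃ α : ℕ → Cardinal, StrictMono α ∧ tweight X = ⨆ n, α n := by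
  let _ := TopologicalSpace.metrizableSpaceMetric X
  have h₀ := (tweight_spec X).1
  obtain h₁ | h₁ := h₀.eq_or_lt
  · refine exists_strictMono_eq_iSup (δ := fun n => (n : Cardinal))
      (fun n => h₁ ▸ natCast_lt_aleph0) ?_
    rw [← h₁]
    refine aleph0_le.2 fun n => ?_
    exact le_ciSup (f := fun n : ℕ => (n : Cardinal.{u})) bddAbove_of_small n
  · obtain ⟨δ, hδ, hle⟩ := exists_tweight_le_sum_of_subcover (exists_subcover_card_lt h₀ h)
    refine exists_strictMono_eq_iSup hδ ?_
    by_contra! hlt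
    exact hle.not_gt (max_lt h₁ (mul_lt_of_lt h₀ h₁ hlt))

end

/-- For an infinite metrizable space `X`, exactly one of the following holds:
(a) `X` contains a discrete subset of cardinality `w(X)`, and then `compCard X` is the
cardinal successor of `w(X)`; or (b) every discrete subset of `X` has cardinality less than
`w(X)`, and then `compCard X = w(X)` and there is a strictly increasing sequence of
cardinals `α₀ < α₁ < ⋯` with `w(X) = ⨆ n, αₙ`. -/
theorem compCard_dichotomy (X : Type*) [TopologicalSpace X] [TopologicalSpace.MetrizableSpace X] [Infinite X] :
    Xor'
      ((∃ D : Set X, IsClosed D ∧ DiscreteTopology D ∧ #D = tweight X) ∧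
        compCard X = Order.succ (tweight X))
      ((∀ D : Set X, IsClosed D → DiscreteTopology D → #D < tweight X) ∧
        compCard X = tweight X ∧
        ∃ α : ℕ → Cardinal, StrictMono α ∧ tweight X = ⨆ n, α n) := by
  have h₀ := (tweight_spec X).1
  by_cases h : ∃ D : Set X, IsClosed D ∧ DiscreteTopology D ∧ #D = tweight X
  · obtain ⟨D, hD, hd, hcard⟩ := h
    refine Or.inl ⟨⟨⟨D, hD, hd, hcard⟩, (compCard_le_succ_tweight X).antisymm ?_⟩,
      fun hb => (hb.1 D hD hd).ne hcard⟩
    exact Order.succ_le_of_lt (hcard ▸ mk_lt_compCard_of_discreteTopology hD hd)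
  · have hlt : ∀ D : Set X, IsClosed D → DiscreteTopology D → #D < tweight X := by
      intro D hD hd
      by_contra! hle
      obtain ⟨S, hSD, hS⟩ := le_mk_iff_exists_subset.1 hle
      exact h ⟨S, hD.of_subset_of_discreteTopology hd hSD, DiscreteTopology.of_subset hd hSD, hS⟩
    let _ := TopologicalSpace.metrizableSpaceMetric X
    exact Or.inr ⟨⟨hlt, (compCard_le h₀ (exists_subcover_card_lt h₀ hlt)).antisymm
      tweight_le_compCard, exists_strictMono_eq_tweight hlt⟩, fun ha => h ha.1⟩
end

section
/- Every weakly separately rigid map h : X → E of a metric space (X,d) into a real normed space (E,‖·‖) is injective, and its image h(X) is a linearly independent subset of E. -/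
open Cardinal

/-- `deltaMin x = min {d (x j) (x k) : j ≠ k}` for `n ≥ 2`, and `≡ 1` for `n ≤ 1`. -/
noncomputable def deltaMin {X : Type*} [MetricSpace X] {n : ℕ} (x : Fin n → X) : ℝ :=
  if 1 < n then sInf {r : ℝ | ∃ j k : Fin n, j ≠ k ∧ r = dist (x j) (x k)} else 1

/-- A map `h : X → E` from a metric space into a real normed space is weakly separately
rigid if for every `n ≥ 1`, `r > 0` and `M ≥ 1` there is `C > 0` such that
`‖∑ j, t j • h (x j)‖ ≥ C` whenever `1/M ≤ |t j| ≤ M` for all `j` and `δ_n(x) ≥ r`. -/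
def WeaklySeparatelyRigid {X E : Type*} [MetricSpace X] [NormedAddCommGroup E]
    [NormedSpace ℝ E] (h : X → E) : Prop :=
  ∀ (n : ℕ), 1 ≤ n → ∀ r M : ℝ, 0 < r → 1 ≤ M →
    ∃ C > 0, ∀ (t : Fin n → ℝ) (x : Fin n → X),
      (∀ j, 1 / M ≤ |t j| ∧ |t j| ≤ M) → r ≤ deltaMin x →
      C ≤ ‖∑ j, t j • h (x j)‖

theorem deltaMin_pos {X : Type*} [MetricSpace X] {n : ℕ} {x : Fin n → X}
    (hx : Function.Injective x) : 0 < deltaMin x := by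
  unfold deltaMin
  split_ifs with hn
  · set S := {r : ℝ | ∃ j k : Fin n, j ≠ k ∧ r = dist (x j) (x k)}
    have hfin : S.Finite := by
      refine (Set.finite_range fun p : Fin n × Fin n => dist (x p.1) (x p.2)).subset ?_
      rintro r ⟨j, k, -, rfl⟩
      exact ⟨(j, k), rfl⟩
    have hne : S.Nonempty :=
      ⟨_, ⟨0, by omega⟩, ⟨1, hn⟩, by simp [Fin.ext_iff], rfl⟩
    obtain ⟨j, k, hjk, h⟩ := hne.csInf_mem hfin
    rw [h]
    exact dist_pos.2 (hx.ne hjk)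
  · exact one_pos

theorem exists_one_le_forall_inv_le_abs_le {n : ℕ} {t : Fin n → ℝ} (ht : ∀ j, t j ≠ 0) :
    ∃ M : ℝ, 1 ≤ M ∧ ∀ j, 1 / M ≤ |t j| ∧ |t j| ≤ M := by
  have hsum (f : Fin n → ℝ) (j : Fin n) : |f j| ≤ ∑ i, |f i| :=
    Finset.single_le_sum (f := fun i => |f i|) (fun i _ => abs_nonneg _) (Finset.mem_univ j)
  have h₁ : 0 ≤ ∑ i, |t i| := Finset.sum_nonneg fun i _ => abs_nonneg _
  have h₂ : 0 ≤ ∑ i, |(t i)⁻¹| := Finset.sum_nonneg fun i _ => abs_nonneg _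
  refine ⟨1 + ∑ i, |t i| + ∑ i, |(t i)⁻¹|, by linarith, fun j => ⟨?_, ?_⟩⟩
  · rw [one_div]
    refine inv_le_of_inv_le₀ (abs_pos.2 (ht j)) ?_
    rw [← abs_inv]
    linarith [hsum (fun i => (t i)⁻¹) j]
  · linarith [hsum t j]

theorem WeaklySeparatelyRigid.sum_smul_ne_zero {X E : Type*} [MetricSpace X]
    [NormedAddCommGroup E] [NormedSpace ℝ E] {h : X → E} (hwsr : WeaklySeparatelyRigid h)
    {n : ℕ} (hn : 1 ≤ n) {t : Fin n → ℝ} (ht : ∀ j, t j ≠ 0) {x : Fin n → X}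
    (hx : Function.Injective x) : ∑ j, t j • h (x j) ≠ 0 := by
  obtain ⟨M, hM, htM⟩ := exists_one_le_forall_inv_le_abs_le ht
  obtain ⟨C, hC, hCle⟩ := hwsr n hn (deltaMin x) M (deltaMin_pos hx) hM
  exact norm_pos_iff.1 (hC.trans_le (hCle t x htM le_rfl))

theorem WeaklySeparatelyRigid.linearIndependent {X E : Type*} [MetricSpace X]
    [NormedAddCommGroup E] [NormedSpace ℝ E] {h : X → E} (hwsr : WeaklySeparatelyRigid h) :
    LinearIndependent ℝ h := by
  rw [linearIndependent_iff]
  intro l hl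
  by_contra hne
  let e := l.support.equivFin.symm
  refine hwsr.sum_smul_ne_zero (n := l.support.card) (t := fun j => l (e j))
    (x := fun j => (e j : X))
    (Finset.card_pos.2 (Finsupp.support_nonempty_iff.2 hne))
    (fun j => Finsupp.mem_support_iff.1 (e j).2)
    (Subtype.val_injective.comp e.injective) ?_
  rw [e.sum_comp fun y : l.support => l y • h y,
    Finset.sum_coe_sort l.support fun y => l y • h y]
  exact hl

/-- Every weakly separately rigid map is injective and its image is a linearly
independent subset of `E`. -/
theorem weaklySeparatelyRigid_injective_linearIndependent {X E : Type*} [MetricSpace X]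
    [NormedAddCommGroup E] [NormedSpace ℝ E] (h : X → E)
    (hwsr : WeaklySeparatelyRigid h) :
    Function.Injective h ∧ LinearIndependent ℝ (fun v : Set.range h => (v : E)) := by
  have hli := hwsr.linearIndependent
  exact ⟨hli.injective, hli.linearIndepOn_id⟩
end
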